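/- Let n ≥ 1, k ≥ 2 and work in the braid group Br_{nk}. For 1 ≤ i < j ≤ nk define m_{ij} := 1 if i ≡ j (mod n); m_{ij} := 3 if i ≢ j (mod n), j ≡ i+1 or j ≡ i−1 (mod n), and the unordered pair of residues {i mod n, j mod n} is not {0,1}; and m_{ij} := 2 otherwise. Then the subgroup of Br_{nk} generated by all powers σ_{i,j}^{m_{ij}} with 1 ≤ i < j ≤ nk equals the subgroup generated by the band generators σ_{i,j} with i ≡ j (mod n) together with the powers σ_{i,j}^{m_{ij}} for those pairs i < j for which there exists s ≡ 0 (mod n) with s < i < j ≤ s + n. -/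

import Mathlib

open Polynomial

noncomputable section

/-- Defining relations of the Artin braid group on `m` strands: the generators are
indexed by `Fin (m - 1)`, with index `i` corresponding to `σ_{i+1}`; the relations are
`σ_i σ_j = σ_j σ_i` for `|i - j| ≥ 2` and `σ_i σ_{i+1} σ_i = σ_{i+1} σ_i σ_{i+1}`. -/
def braidRels (m : ℕ) : Set (FreeGroup (Fin (m - 1))) :=
  { r | (∃ i j : Fin (m - 1), (i : ℕ) + 2 ≤ (j : ℕ) ∧
          r = .of i * .of j * (.of i)⁻¹ * (.of j)⁻¹) ∨
        (∃ i j : Fin (m - 1), (j : ℕ) = (i : ℕ) + 1 ∧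
          r = .of i * .of j * .of i * (.of j * .of i * .of j)⁻¹) }

/-- The Artin braid group on `m` strands. -/
def BraidGroup (m : ℕ) : Type := PresentedGroup (braidRels m)

instance (m : ℕ) : Group (BraidGroup m) :=
  inferInstanceAs (Group (PresentedGroup (braidRels m)))

/-- The Artin generator `σ_i` of the braid group on `m` strands, for `1 ≤ i ≤ m - 1`
(junk value `1` for invalid indices). -/
def σg (m : ℕ) (i : ℕ) : BraidGroup m :=
  if h : 0 < i ∧ i < m then PresentedGroup.of ⟨i - 1, by omega⟩ else 1

/-- The band generator `σ_{i,j} = (σ_{j-1} σ_{j-2} ⋯ σ_{i+1}) σ_i (σ_{j-1} σ_{j-2} ⋯ σ_{i+1})⁻¹`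
of the braid group on `m` strands; in particular `σ_{i,i+1} = σ_i`. -/
def band (m i j : ℕ) : BraidGroup m :=
  (((List.range' (i + 1) (j - i - 1)).reverse.map (σg m)).prod) * σg m i *
    (((List.range' (i + 1) (j - i - 1)).reverse.map (σg m)).prod)⁻¹

/-- The exponent `m_{ij}` (with respect to the modulus `n`): `1` if `i ≡ j (mod n)`;
`3` if `i ≢ j (mod n)`, `j ≡ i + 1` or `j ≡ i - 1 (mod n)`, and the unordered pair of
residues `{i mod n, j mod n}` differs from `{0 mod n, 1 mod n}`; `2` otherwise. -/
def mExp (n i j : ℕ) : ℕ :=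
  if i % n = j % n then 1
  else if ((i + 1) % n = j % n ∨ (j + 1) % n = i % n) ∧
      ¬((i % n = 0 % n ∧ j % n = 1 % n) ∨ (i % n = 1 % n ∧ j % n = 0 % n)) then 3
  else 2

theorem σg_of_not_valid {m i : ℕ} (h : ¬(0 < i ∧ i < m)) : σg m i = 1 := dif_neg h

theorem σg_of_valid {m i : ℕ} (h : 0 < i ∧ i < m) :
    σg m i = (PresentedGroup.of ⟨i - 1, by omega⟩ : PresentedGroup (braidRels m)) := dif_pos h

theorem σg_commute (m : ℕ) {i j : ℕ} (h : i + 2 ≤ j) : Commute (σg m i) (σg m j) := by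
  by_cases hi : 0 < i ∧ i < m
  swap
  · rw [σg_of_not_valid hi]; exact Commute.one_left _
  by_cases hj : 0 < j ∧ j < m
  swap
  · rw [σg_of_not_valid hj]; exact Commute.one_right _
  let a : Fin (m - 1) := ⟨i - 1, by omega⟩
  let b : Fin (m - 1) := ⟨j - 1, by omega⟩
  have hr : (.of a * .of b * (.of a)⁻¹ * (.of b)⁻¹ : FreeGroup (Fin (m - 1))) ∈ braidRels m :=
    Or.inl ⟨a, b, by simp only [a, b]; omega, rfl⟩
  have h1 := PresentedGroup.one_of_mem hr
  simp only [map_mul, map_inv] at h1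
  rw [σg_of_valid hi, σg_of_valid hj]
  exact mul_inv_eq_iff_eq_mul.mp (mul_inv_eq_one.mp h1)

theorem σg_braid (m : ℕ) {i : ℕ} (hi : 0 < i) (h : i + 1 < m) :
    σg m i * σg m (i + 1) * σg m i = σg m (i + 1) * σg m i * σg m (i + 1) := by
  let a : Fin (m - 1) := ⟨i - 1, by omega⟩
  let b : Fin (m - 1) := ⟨i + 1 - 1, by omega⟩
  have hr : (.of a * .of b * .of a * (.of b * .of a * .of b)⁻¹ :
      FreeGroup (Fin (m - 1))) ∈ braidRels m :=
    Or.inr ⟨a, b, by simp only [a, b]; omega, rfl⟩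
  have h1 := PresentedGroup.one_of_mem hr
  rw [map_mul, map_inv] at h1
  rw [σg_of_valid ⟨hi, by omega⟩, σg_of_valid ⟨i.succ_pos, h⟩]
  exact mul_inv_eq_one.mp h1

theorem band_self_succ (m i : ℕ) : band m i (i + 1) = σg m i := by
  simp [band]

theorem band_succ (m : ℕ) {i j : ℕ} (h : i < j) :
    band m i (j + 1) = σg m j * band m i j * (σg m j)⁻¹ := by
  obtain ⟨d, rfl⟩ := Nat.exists_eq_add_of_lt h
  have h1 : i + d + 1 + 1 - i - 1 = d + 1 := by omega
  have h2 : i + d + 1 - i - 1 = d := by omega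
  have h3 : i + 1 + d = i + d + 1 := by omega
  simp only [band, h1, h2, List.range'_concat, List.reverse_append, List.map_append,
    List.prod_append, one_mul, h3]
  simp [mul_assoc]

theorem σg_commute_band (m : ℕ) {i j l : ℕ} (hij : i < j) (hjl : j < l) :
    Commute (σg m l) (band m i j) := by
  induction j, Nat.succ_le_of_lt hij using Nat.le_induction with
  | base => rw [Nat.succ_eq_add_one, band_self_succ]; exact (σg_commute m (by omega)).symm
  | succ j hj ih =>
    have hc : Commute (σg m l) (σg m j) := (σg_commute m (by omega)).symm
    rw [band_succ m hj]
    exact (hc.mul_right (ih hj (by omega))).mul_right hc.inv_right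

theorem braid_conj {G : Type*} [Group G] {x y z : G} (hxz : Commute x z)
    (hxy : y * x * y = x * y * x) (hyz : z * y * z = y * z * y) :
    (y * z * y⁻¹) * x * (y * z * y⁻¹) = x * (y * z * y⁻¹) * x := by
  have h : y * z * y⁻¹ = z⁻¹ * y * z := by
    rw [mul_inv_eq_iff_eq_mul, mul_assoc, mul_assoc, eq_inv_mul_iff_mul_eq, ← mul_assoc,
      ← mul_assoc, hyz]
  have hx : x = z⁻¹ * x * z := by rw [mul_assoc, hxz.eq, inv_mul_cancel_left]
  rw [h]
  calc z⁻¹ * y * z * x * (z⁻¹ * y * z)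
      = z⁻¹ * y * z * (z⁻¹ * x * z) * (z⁻¹ * y * z) := by rw [← hx]
    _ = z⁻¹ * (y * x * y) * z := by group
    _ = (z⁻¹ * x * z) * (z⁻¹ * y * z) * (z⁻¹ * x * z) := by rw [hxy]; group
    _ = x * (z⁻¹ * y * z) * x := by rw [← hx]

theorem band_braid_σg (m : ℕ) {i j : ℕ} (hi : 0 < i) (hij : i < j) (hjm : j < m) :
    band m i j * σg m j * band m i j = σg m j * band m i j * σg m j := by
  induction j, Nat.succ_le_of_lt hij using Nat.le_induction with
  | base => rw [Nat.succ_eq_add_one, band_self_succ]; exact σg_braid m hi hjm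
  | succ j hj ih =>
    rw [band_succ m hj]
    exact braid_conj (σg_commute_band m hj (by omega)) (σg_braid m (by omega) hjm)
      (ih hj (by omega))

theorem band_mul_band (m : ℕ) {i j l : ℕ} (hi : 0 < i) (hij : i < j) (hjl : j < l)
    (hlm : l ≤ m) :
    band m j l * band m i j = band m i l * band m j l ∧
      band m j l * band m i j = band m i j * band m i l := by
  induction l, Nat.succ_le_of_lt hjl using Nat.le_induction with
  | base =>
    rw [Nat.succ_eq_add_one, band_self_succ, band_succ m hij]
    refine ⟨by group, ?_⟩
    rw [← mul_assoc, eq_mul_inv_iff_mul_eq, ← mul_assoc]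
    exact (band_braid_σg m hi hij (by omega)).symm
  | succ l hl ih =>
    obtain ⟨h1, h2⟩ := ih hl (by omega)
    have hc := σg_commute_band m hij hl
    have hb : band m i j = σg m l * band m i j * (σg m l)⁻¹ := by
      rw [hc.eq, mul_inv_cancel_right]
    rw [band_succ m hl, band_succ m (hij.trans hl), hb]
    constructor
    · simpa using congrArg (fun g => σg m l * g * (σg m l)⁻¹) h1
    · simpa using congrArg (fun g => σg m l * g * (σg m l)⁻¹) h2

theorem mExp_comm (n i j : ℕ) : mExp n i j = mExp n j i := by
  unfold mExp
  grind

theorem mExp_congr_left {n i i' : ℕ} (h : i % n = i' % n) (j : ℕ) :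
    mExp n i j = mExp n i' j := by
  have h1 : (i + 1) % n = (i' + 1) % n := Nat.ModEq.add_right 1 h
  simp only [mExp, h, h1]

theorem Subgroup.pow_mem_of_mul_eq_mul {G : Type*} [Group G] {H : Subgroup G} {g x y : G}
    (hg : g ∈ H) (h : g * x = y * g) (e : ℕ) : x ^ e ∈ H ↔ y ^ e ∈ H := by
  have hy : y = g * x * g⁻¹ := eq_mul_inv_of_mul_eq h.symm
  rw [hy, conj_pow, H.mul_mem_cancel_right (H.inv_mem hg), H.mul_mem_cancel_left hg]

theorem exists_modEq_in_block {n i j : ℕ} (hn : 1 ≤ n) (hi : 1 ≤ i) (hij : i < j) :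
    ∃ i' s, n ∣ s ∧ s < i' ∧ i' ≤ s + n ∧ s < j ∧ j ≤ s + n ∧ i ≤ i' ∧ i % n = i' % n := by
  have hj := Nat.div_add_mod (j - 1) n
  have hi' := Nat.div_add_mod (i - 1) n
  have hjlt := Nat.mod_lt (j - 1) hn
  have hilt := Nat.mod_lt (i - 1) hn
  have hle : n * ((i - 1) / n) ≤ n * ((j - 1) / n) :=
    Nat.mul_le_mul_left _ (Nat.div_le_div_right (by omega))
  refine ⟨n * ((j - 1) / n) + ((i - 1) % n + 1), n * ((j - 1) / n), dvd_mul_right _ _,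
    by omega, by omega, by omega, by omega, by omega, ?_⟩
  rw [Nat.mul_add_mod, Nat.mod_add_mod]
  congr 1
  omega

/-- For `n ≥ 1`, `k ≥ 2`, the subgroup of `Br_{nk}` generated by all powers
`σ_{i,j}^{m_{ij}}` equals the subgroup generated by the band generators `σ_{i,j}` with
`i ≡ j (mod n)` together with the powers `σ_{i,j}^{m_{ij}}` for the pairs `i < j` lying
in a single block `s < i < j ≤ s + n` with `n ∣ s`. -/
theorem mExp_power_subgroup_reduction (n k : ℕ) (hn : 1 ≤ n) (hk : 2 ≤ k) :
    Subgroup.closure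
        { b : BraidGroup (n * k) | ∃ i j : ℕ, 1 ≤ i ∧ i < j ∧ j ≤ n * k ∧
            b = band (n * k) i j ^ mExp n i j } =
      Subgroup.closure
        ({ b : BraidGroup (n * k) | ∃ i j : ℕ, 1 ≤ i ∧ i < j ∧ j ≤ n * k ∧
            i % n = j % n ∧ b = band (n * k) i j } ∪
         { b : BraidGroup (n * k) | ∃ i j s : ℕ, n ∣ s ∧ s < i ∧ i < j ∧ j ≤ s + n ∧
            j ≤ n * k ∧ b = band (n * k) i j ^ mExp n i j }) := by
  apply le_antisymm <;> rw [Subgroup.closure_le]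
  · rintro _ ⟨i, j, hi, hij, hj, rfl⟩
    set H := Subgroup.closure
        ({ b : BraidGroup (n * k) | ∃ i j : ℕ, 1 ≤ i ∧ i < j ∧ j ≤ n * k ∧
            i % n = j % n ∧ b = band (n * k) i j } ∪
         { b : BraidGroup (n * k) | ∃ i j s : ℕ, n ∣ s ∧ s < i ∧ i < j ∧ j ≤ s + n ∧
            j ≤ n * k ∧ b = band (n * k) i j ^ mExp n i j })
    have hcong : ∀ {a b : ℕ}, 1 ≤ a → a < b → b ≤ n * k → a % n = b % n →
        band (n * k) a b ∈ H := fun {a b} ha hab hb h =>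
      Subgroup.subset_closure (Or.inl ⟨a, b, ha, hab, hb, h, rfl⟩)
    have hblock : ∀ {a b s : ℕ}, n ∣ s → s < a → a < b → b ≤ s + n → b ≤ n * k →
        band (n * k) a b ^ mExp n a b ∈ H := fun {a b s} hs ha hab hbs hb =>
      Subgroup.subset_closure (Or.inr ⟨a, b, s, hs, ha, hab, hbs, hb, rfl⟩)
    rw [SetLike.mem_coe]
    obtain ⟨i', s, hs, hsi, his, hsj, hjs, hii, hmod⟩ := exists_modEq_in_block hn hi hij
    have hsk : s + n ≤ n * k := by
      obtain ⟨q, rfl⟩ := hs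
      have hq : q < k := lt_of_mul_lt_mul_left (hsj.trans_le hj) n.zero_le
      exact Nat.mul_le_mul_left n hq
    rcases hii.eq_or_lt with rfl | hlt
    · exact hblock hs hsi hij hjs hj
    have hg := hcong hi hlt (his.trans hsk) hmod
    rcases lt_trichotomy i' j with h | rfl | h
    · obtain ⟨h1, h2⟩ := band_mul_band (n * k) hi hlt h hj
      rw [Subgroup.pow_mem_of_mul_eq_mul hg (h2.symm), mExp_congr_left hmod]
      exact hblock hs hsi h hjs hj
    · rw [show mExp n i i' = 1 by simp [mExp, hmod], pow_one]
      exact hg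
    · obtain ⟨h1, h2⟩ := band_mul_band (n * k) hi hij h (his.trans hsk)
      rw [← Subgroup.pow_mem_of_mul_eq_mul hg (h1.symm.trans h2), mExp_congr_left hmod,
        mExp_comm]
      exact hblock hs hsj h his (his.trans hsk)
  · rintro _ (⟨i, j, hi, hij, hj, h, rfl⟩ | ⟨i, j, s, -, hs, hij, -, hj, rfl⟩)
    · exact Subgroup.subset_closure ⟨i, j, hi, hij, hj, by simp [mExp, h]⟩
    · exact Subgroup.subset_closure ⟨i, j, by omega, hij, hj, rfl⟩

end
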